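/- There exists a preordered space (X, ≼) which admits a countable multi-utility but in which every Debreu upper dense subset is uncountable; in particular, X = ℕ ∪ P_inf(ℕ) (where P_inf(ℕ) is the set of infinite subsets of ℕ) with the preorder x ≼ y iff x = y, or (x ∈ ℕ, y ∈ P_inf(ℕ) and x ∈ y), has this property. -/

import Mathlib

/-- A family `(v i)_{i ∈ I}` of real-valued functions is a multi-utility for the
preorder on `X` if `x ≼ y ↔ ∀ i, v i x ≤ v i y`. -/
def IsMultiUtility {X I : Type*} [Preorder X] (v : I → X → ℝ) : Prop :=
  ∀ x y : X, x ≤ y ↔ ∀ i, v i x ≤ v i y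

/-- `x ⋈ y`: `x` and `y` are incomparable. -/
def Incomp {X : Type*} [Preorder X] (x y : X) : Prop :=
  ¬ x ≤ y ∧ ¬ y ≤ x

/-- A subset `Z ⊆ X` is Debreu upper dense if whenever `x ⋈ y` there is `z ∈ Z`
with `x ⋈ z` and `z ≼ y`. -/
def DebreuUpperDense {X : Type*} [Preorder X] (Z : Set X) : Prop :=
  ∀ x y : X, Incomp x y → ∃ z ∈ Z, Incomp x z ∧ z ≤ y

/-- The ground set `ℕ ∪ P_inf(ℕ)`: the disjoint union of `ℕ` and the set of
infinite subsets of `ℕ`. -/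
structure NatOrInfSet : Type where
  val : ℕ ⊕ {s : Set ℕ // s.Infinite}

/-- The preorder: `x ≼ y` iff `x = y`, or `x ∈ ℕ`, `y ∈ P_inf(ℕ)` and `x ∈ y`. -/
instance : Preorder NatOrInfSet where
  le x y := x = y ∨ ∃ (n : ℕ) (s : {s : Set ℕ // s.Infinite}),
    x.val = Sum.inl n ∧ y.val = Sum.inr s ∧ n ∈ s.1
  le_refl x := Or.inl rfl
  le_trans := by
    rintro x y z (rfl | ⟨n, s, hx, hy, hn⟩) hyz
    · exact hyz
    · rcases hyz with rfl | ⟨m, t, hy', hz, hm⟩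
      · exact Or.inr ⟨n, s, hx, hy, hn⟩
      · rw [hy] at hy'
        exact absurd hy' (by simp)

/-- Up-set of `n`. -/
def upSet (n : ℕ) : NatOrInfSet → Prop
  | ⟨Sum.inl m⟩ => m = n
  | ⟨Sum.inr s⟩ => n ∈ s.1

/-- Infinite sets avoiding `n`. -/
def avoidSet (n : ℕ) : NatOrInfSet → Prop
  | ⟨Sum.inl _⟩ => False
  | ⟨Sum.inr s⟩ => n ∉ s.1

open Classical in
theorem exists_mu : ∃ v : ℕ → NatOrInfSet → ℝ, IsMultiUtility v := by
  refine ⟨fun k x => if (if k % 2 = 0 then upSet (k / 2) x else avoidSet (k / 2) x) then 1 else 0, ?_⟩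
  intro x y
  constructor
  · intro h k
    rcases h with rfl | ⟨n, s, hx, hy, hn⟩
    · exact le_rfl
    · obtain ⟨x⟩ := x
      obtain ⟨y⟩ := y
      simp only at hx hy
      subst hx hy
      by_cases hk : k % 2 = 0
      · simp only [hk, if_true, upSet]
        split_ifs with h1 h2
        · exact le_rfl
        · exact absurd (h1 ▸ hn) h2
        · exact zero_le_one
        · exact le_rfl
      · simp only [hk, if_false, avoidSet]
        split_ifs <;> norm_num
  · intro h
    have hU : ∀ n, upSet n x → upSet n y := by
      intro n hx
      by_contra hy
      have := h (2 * n)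
      simp [hx, hy] at this
      linarith
    have hW : ∀ n, avoidSet n x → avoidSet n y := by
      intro n hx
      by_contra hy
      have := h (2 * n + 1)
      have e : (2 * n + 1) / 2 = n := by omega
      have e2 : (2 * n + 1) % 2 = 1 := by omega
      simp [hx, hy, e] at this
      linarith
    clear h
    obtain ⟨x⟩ := x
    obtain ⟨y⟩ := y
    rcases x with n | s <;> rcases y with m | t <;> simp only [upSet, avoidSet] at hU hW
    · exact Or.inl (by rw [hU n rfl])
    · exact Or.inr ⟨n, t, rfl, rfl, hU n rfl⟩
    · exfalso
      exact s.2 ((Set.finite_singleton m).subset fun n hn => (hU n hn).symm)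
    · left
      congr 2
      ext n
      exact ⟨hU n, fun h => by_contra fun hn => hW n hn h⟩

/-- Coding of subsets of `ℕ` by infinite sets avoiding `0`. -/
def code (A : Set ℕ) : Set ℕ := {k | k % 2 = 1 ∨ ∃ n ∈ A, k = 2 * n + 2}

theorem code_infinite (A : Set ℕ) : (code A).Infinite := by
  refine Set.infinite_of_injective_forall_mem (f := fun n : ℕ => 2 * n + 1) ?_ ?_
  · intro a b h
    simp only at h
    omega
  · intro n
    left
    omega

theorem zero_notMem_code (A : Set ℕ) : 0 ∉ code A := by
  rintro (h | ⟨n, _, h⟩) <;> omega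

theorem mem_code (A : Set ℕ) (n : ℕ) : 2 * n + 2 ∈ code A ↔ n ∈ A := by
  constructor
  · rintro (h | ⟨m, hm, h⟩)
    · omega
    · have : n = m := by omega
      exact this ▸ hm
  · intro h
    exact Or.inr ⟨n, h, rfl⟩

theorem dense_uncountable (Z : Set NatOrInfSet) (hZ : DebreuUpperDense Z) : ¬ Z.Countable := by
  intro hc
  let f : Set ℕ → NatOrInfSet := fun A => ⟨Sum.inr ⟨code A, code_infinite A⟩⟩
  have hf : Function.Injective f := by
    intro A B h
    have hcode : code A = code B := by simpa [f] using h
    ext n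
    rw [← mem_code A, hcode, mem_code]
  have hall : ∀ A, f A ∈ Z := by
    intro A
    have hne : code A ≠ Set.univ := fun h => zero_notMem_code A (h ▸ Set.mem_univ 0)
    obtain ⟨z, hz, hi, hle⟩ := hZ ⟨Sum.inr ⟨Set.univ, Set.infinite_univ⟩⟩ (f A) (by
      constructor
      · rintro (h | ⟨n, s, h, _⟩)
        · simp [f] at h
          exact hne h.symm
        · simp at h
      · rintro (h | ⟨n, s, h, _⟩)
        · simp [f] at h
          exact hne h
        · simp [f] at h)
    rcases hle with rfl | ⟨n, s, h, _⟩
    · exact hz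
    · exact absurd (Or.inr ⟨n, _, h, rfl, Set.mem_univ n⟩) hi.2
  have h1 : (f ⁻¹' Z).Countable := hc.preimage_of_injOn hf.injOn
  have h2 : f ⁻¹' Z = Set.univ := Set.eq_univ_of_forall hall
  rw [h2, Set.countable_univ_iff] at h1
  obtain ⟨g, hg⟩ := h1.exists_injective_nat
  exact Function.cantor_injective g hg

/-- The space `X = ℕ ∪ P_inf(ℕ)` with the preorder `x ≼ y` iff
`x = y` or (`x ∈ ℕ`, `y ∈ P_inf(ℕ)` and `x ∈ y`) admits a countable multi-utility,
yet every Debreu upper dense subset of it is uncountable. In particular such a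
preordered space exists. -/
theorem stmt_18 :
    ((∃ v : ℕ → NatOrInfSet → ℝ, IsMultiUtility v) ∧
      ∀ Z : Set NatOrInfSet, DebreuUpperDense Z → ¬ Z.Countable) ∧
    ∃ (X : Type) (_ : Preorder X),
      (∃ v : ℕ → X → ℝ, IsMultiUtility v) ∧
      ∀ Z : Set X, DebreuUpperDense Z → ¬ Z.Countable := by
  exact ⟨⟨exists_mu, dense_uncountable⟩, NatOrInfSet, inferInstance, exists_mu, dense_uncountable⟩
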